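/- Let A be an m×n real matrix and b ∈ ℝ^m. The system of affine inequalities {x ∈ ℝ^n | ∀ i, (A.mulVec x) i + b i ≥ 0} is empty (unsatisfiable) if and only if there exist a real number λ₀ ≥ 0 and a vector λ ∈ ℝ^m with λ i ≥ 0 for all i, such that ∑ i, λ i * A i j = 0 for every j, and λ₀ + ∑ i, λ i * b i = -1. -/

import Mathlib

/-- Finitely many lower bounds, each below each of finitely many upper bounds, leave room for a
common point. -/
lemma exists_forall_le_and_forall_le {α β K : Type*} [Finite α] [Finite β] [LinearOrder K]
    [Nonempty K] (f : α → K) (g : β → K) (h : ∀ i j, f i ≤ g j) :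
    ∃ t, (∀ i, f i ≤ t) ∧ ∀ j, t ≤ g j := by
  rcases isEmpty_or_nonempty α with _ | _
  · obtain ⟨t, ht⟩ := (Set.finite_range g).bddBelow
    exact ⟨t, isEmptyElim, fun j ↦ ht ⟨j, rfl⟩⟩
  · obtain ⟨i, hi⟩ := Finite.exists_max f
    exact ⟨f i, hi, h i⟩

section FourierMotzkin

open Matrix

variable {ι K : Type*} [Field K] [LinearOrder K]

/-- The row operations eliminating a variable with coefficients `a` from a system of
inequalities. -/
def fourierMotzkin [DecidableEq ι] (a : ι → K) :
    Matrix ({i // a i = 0} ⊕ {i // 0 < a i} × {i // a i < 0}) ι K :=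
  Matrix.of <| Sum.elim (fun i ↦ Pi.single i.1 1)
    fun r ↦ Pi.single r.2.1 (a r.1) - Pi.single r.1.1 (a r.2)

lemma fourierMotzkin_nonneg [IsStrictOrderedRing K] [DecidableEq ι] (a : ι → K) (k) (i : ι) :
    0 ≤ fourierMotzkin a k i := by
  rcases k with j | ⟨p, q⟩
  · have hj : (0 : ι → K) ≤ Pi.single j.1 1 := Pi.single_nonneg.2 zero_le_one
    exact hj i
  · have hp : (0 : ι → K) ≤ Pi.single q.1 (a p) := Pi.single_nonneg.2 p.2.le
    have hq : (Pi.single p.1 (a q) : ι → K) ≤ 0 := Pi.single_nonpos.2 q.2.le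
    exact sub_nonneg.2 ((hq i).trans (hp i))

variable [Fintype ι] [DecidableEq ι]

lemma fourierMotzkin_mulVec_inl (a v : ι → K) (i : {i // a i = 0}) :
    (fourierMotzkin a *ᵥ v) (Sum.inl i) = v i := by
  simp [fourierMotzkin, mulVec]

lemma fourierMotzkin_mulVec_inr (a v : ι → K) (r : {i // 0 < a i} × {i // a i < 0}) :
    (fourierMotzkin a *ᵥ v) (Sum.inr r) = a r.1 * v r.2 - a r.2 * v r.1 := by
  change (Pi.single r.2.1 (a r.1) - Pi.single r.1.1 (a r.2)) ⬝ᵥ v = _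
  rw [sub_dotProduct, single_dotProduct, single_dotProduct]

lemma fourierMotzkin_mulVec_self (a : ι → K) : fourierMotzkin a *ᵥ a = 0 := by
  ext (i | r)
  · simp [fourierMotzkin_mulVec_inl, i.2]
  · simp [fourierMotzkin_mulVec_inr, mul_comm]

variable [IsStrictOrderedRing K]

lemma exists_forall_nonneg_of_fourierMotzkin (a c : ι → K)
    (h : ∀ k, 0 ≤ (fourierMotzkin a *ᵥ c) k) : ∃ t, ∀ i, 0 ≤ a i * t + c i := by
  obtain ⟨t, hlo, hhi⟩ := exists_forall_le_and_forall_le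
    (fun p : {i // 0 < a i} ↦ -c p / a p) (fun q : {i // a i < 0} ↦ -c q / a q) (by
      intro p q
      have hpq := h (Sum.inr (p, q))
      rw [fourierMotzkin_mulVec_inr] at hpq
      rw [div_le_iff₀ p.2, div_mul_eq_mul_div, le_div_iff_of_neg q.2]
      linarith)
  refine ⟨t, fun i ↦ ?_⟩
  rcases lt_trichotomy (a i) 0 with hi | hi | hi
  · have := hhi ⟨i, hi⟩
    rw [le_div_iff_of_neg hi] at this
    linarith
  · simpa [hi, fourierMotzkin_mulVec_inl] using h (Sum.inl ⟨i, hi⟩)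
  · have := hlo ⟨i, hi⟩
    rw [div_le_iff₀ hi] at this
    linarith

end FourierMotzkin

open Matrix in
/-- An unsatisfiable system of affine inequalities has a refutation by nonnegative multipliers. -/
theorem exists_nonneg_vecMul_eq_zero_dotProduct_eq_neg_one {K : Type*} [Field K] [LinearOrder K]
    [IsStrictOrderedRing K] {n : ℕ} {ι : Type*} [Fintype ι] (A : Matrix ι (Fin n) K) (b : ι → K)
    (h : ¬ ∃ x, ∀ i, 0 ≤ (A *ᵥ x) i + b i) :
    ∃ l : ι → K, (∀ i, 0 ≤ l i) ∧ l ᵥ* A = 0 ∧ l ⬝ᵥ b = -1 := by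
  classical
  induction n generalizing ι with
  | zero =>
    push Not at h
    obtain ⟨i, hi⟩ := h 0
    rw [mulVec_zero, Pi.zero_apply, zero_add] at hi
    have hl : (0 : ι → K) ≤ Pi.single i (-(b i)⁻¹) :=
      Pi.single_nonneg.2 (neg_nonneg.2 (inv_nonpos.2 hi.le))
    exact ⟨Pi.single i (-(b i)⁻¹), hl, Subsingleton.elim _ _, by simp [hi.ne]⟩
  | succ n ih =>
    set a : ι → K := fun i ↦ A i 0
    set B : Matrix ι (Fin n) K := A.submatrix id Fin.succ
    obtain ⟨l, hl, hB, hb⟩ := ih (fourierMotzkin a * B) (fourierMotzkin a *ᵥ b) (by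
      rintro ⟨x, hx⟩
      obtain ⟨t, ht⟩ := exists_forall_nonneg_of_fourierMotzkin a (B *ᵥ x + b)
        (by simpa [mulVec_add] using hx)
      refine h ⟨Fin.cons t x, fun i ↦ (ht i).trans_eq ?_⟩
      simp [mulVec, dotProduct, Fin.sum_univ_succ, a, B, add_assoc])
    refine ⟨l ᵥ* fourierMotzkin a, fun i ↦ ?_, ?_, ?_⟩
    · exact Finset.sum_nonneg fun k _ ↦ mul_nonneg (hl k) (fourierMotzkin_nonneg a k i)
    · ext j
      refine Fin.cases ?_ (fun j ↦ ?_) j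
      · change l ᵥ* fourierMotzkin a ⬝ᵥ a = 0
        rw [← dotProduct_mulVec, fourierMotzkin_mulVec_self, dotProduct_zero]
      · rw [← vecMul_vecMul] at hB
        exact congrFun hB j
    · rw [← dotProduct_mulVec, hb]

/-- **Farkas' Lemma (unsatisfiability case).**
The system of affine inequalities `∀ i, (A.mulVec x) i + b i ≥ 0` is unsatisfiable iff
the false inequality `-1 ≥ 0` can be derived as a nonnegative combination of its rows
together with the trivial inequality `1 ≥ 0`: there exist `λ₀ ≥ 0` and `λ ≥ 0` with
`∑ i, λ i * A i j = 0` for every `j` and `λ₀ + ∑ i, λ i * b i = -1`. -/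
theorem farkas_lemma_unsatisfiable_case
    {m n : ℕ} (A : Matrix (Fin m) (Fin n) ℝ) (b : Fin m → ℝ) :
    (¬ ∃ x : Fin n → ℝ, ∀ i, A.mulVec x i + b i ≥ 0) ↔
      ∃ (l0 : ℝ) (l : Fin m → ℝ), l0 ≥ 0 ∧ (∀ i, l i ≥ 0) ∧
        (∀ j, ∑ i, l i * A i j = 0) ∧ l0 + ∑ i, l i * b i = -1 := by
  constructor
  · intro h
    obtain ⟨l, hl, hA, hb⟩ := exists_nonneg_vecMul_eq_zero_dotProduct_eq_neg_one A b h
    exact ⟨0, l, le_rfl, hl, congrFun hA, by rw [zero_add]; exact hb⟩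
  · rintro ⟨l0, l, hl0, hl, hA, hb⟩ ⟨x, hx⟩
    have hA' : Matrix.vecMul l A = 0 := funext hA
    have hsum : 0 ≤ l ⬝ᵥ (A.mulVec x + b) :=
      Finset.sum_nonneg fun i _ ↦ mul_nonneg (hl i) (hx i)
    rw [dotProduct_add, Matrix.dotProduct_mulVec, hA', zero_dotProduct, zero_add] at hsum
    have hsum' : 0 ≤ ∑ i, l i * b i := hsum
    linarith
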